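/- arXiv:2408.16459 — 6 statements merged into one kernel-verified Lean document; each statement's English description precedes it below -/
import Mathlib

section
/- Let G be a group and let g1, g2, g3 ∈ G. In M(G,2), the elements (g1,0), (g2,1), (g3,0) associate in the order written, i.e. ((g1,0)∘(g2,1))∘(g3,0) = (g1,0)∘((g2,1)∘(g3,0)), if and only if g1·g3 = g3·g1. -/
/-- The operation of the Moufang loop `M(G,2)` on `G × ZMod 2`:
`(g₁,α₁) ∘ (g₂,α₂) = (g₁^(1-α₂) · g₂^((-1)^α₁) · g₁^α₂, α₁+α₂)`,
where the exponents use the integer representatives `0` and `1` of `ZMod 2`. -/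
def Mop {G : Type*} [Group G] (a b : G × ZMod 2) : G × ZMod 2 :=
  (a.1 ^ (1 - (b.2.val : ℤ)) * b.1 ^ ((-1 : ℤ) ^ a.2.val) * a.1 ^ (b.2.val : ℤ),
    a.2 + b.2)

theorem assoc_010_iff {G : Type*} [Group G] (g1 g2 g3 : G) :
    Mop (Mop (g1, (0 : ZMod 2)) (g2, (1 : ZMod 2))) (g3, (0 : ZMod 2)) =
      Mop (g1, (0 : ZMod 2)) (Mop (g2, (1 : ZMod 2)) (g3, (0 : ZMod 2))) ↔
    g1 * g3 = g3 * g1 := by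
  have val_zero : (0 : ZMod 2).val = 0 := rfl
  have val_one : (1 : ZMod 2).val = 1 := rfl
  simp only [Mop, zero_add, add_zero, val_zero, val_one, Prod.mk.injEq, and_true]
  simp only [Nat.cast_zero, Nat.cast_one, sub_self, sub_zero, pow_zero, pow_one, zpow_zero,
    zpow_one, zpow_neg_one, one_mul, mul_one, mul_assoc, mul_right_inj]
  exact Commute.inv_right_iff
end

section
/- Let G be a group and let g1, g2, g3 ∈ G. In M(G,2), the elements (g1,1), (g2,0), (g3,1) associate in the order written, i.e. ((g1,1)∘(g2,0))∘(g3,1) = (g1,1)∘((g2,0)∘(g3,1)), if and only if g2·(g3⁻¹·g1) = (g3⁻¹·g1)·g2. -/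
theorem assoc_101_iff {G : Type*} [Group G] (g1 g2 g3 : G) :
    Mop (Mop (g1, (1 : ZMod 2)) (g2, (0 : ZMod 2))) (g3, (1 : ZMod 2)) =
      Mop (g1, (1 : ZMod 2)) (Mop (g2, (0 : ZMod 2)) (g3, (1 : ZMod 2))) ↔
    g2 * (g3⁻¹ * g1) = (g3⁻¹ * g1) * g2 := by
  have val_one : (1 : ZMod 2).val = 1 := rfl
  have key (h : G) : h * g2⁻¹ = g2⁻¹ * h ↔ g2 * h = h * g2 := by
    rw [mul_inv_eq_iff_eq_mul, mul_assoc, eq_inv_mul_iff_mul_eq]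
  simpa [Mop, val_one, mul_assoc] using key (g3⁻¹ * g1)
end

section
/- Let n ≥ 3. For any two distinct vertices u and v of the associating hypergraph H on M(D_n,2), there is a hyperedge of H containing both u and v; equivalently, the distance d(u,v) between any two distinct vertices of H equals 1. -/
/-- `x`, `y`, `z` associate in the order they are written. -/
def Assoc3 {G : Type*} [Group G] (x y z : G × ZMod 2) : Prop :=
  Mop (Mop x y) z = Mop x (Mop y z)

/-- `e` is a hyperedge of the associating hypergraph on `M(Dₙ,2)`: a set of three
pairwise distinct vertices that associate in some order. -/
def IsEdge {n : ℕ} (e : Finset (DihedralGroup n × ZMod 2)) : Prop :=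
  ∃ a b c : DihedralGroup n × ZMod 2,
    a ≠ b ∧ a ≠ c ∧ b ≠ c ∧ e = {a, b, c} ∧ Assoc3 a b c

theorem one_mop {G : Type*} [Group G] (a : G × ZMod 2) : Mop (1, 0) a = a := by
  simp [Mop]

/-- The identity of `M(G,2)` associates with every pair of elements. -/
theorem assoc3_one_left {G : Type*} [Group G] (y z : G × ZMod 2) : Assoc3 (1, 0) y z := by
  simp only [Assoc3, one_mop]

theorem isEdge_one {n : ℕ} {y z : DihedralGroup n × ZMod 2}
    (hy : y ≠ (1, 0)) (hz : z ≠ (1, 0)) (hyz : y ≠ z) : IsEdge {(1, 0), y, z} :=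
  ⟨_, y, z, hy.symm, hz.symm, hyz, rfl, assoc3_one_left y z⟩

theorem exists_ne_one_and_ne {n : ℕ} (v : DihedralGroup n × ZMod 2) :
    ∃ w : DihedralGroup n × ZMod 2, w ≠ (1, 0) ∧ w ≠ v := by
  by_cases hv : v = (1, 1)
  · exact ⟨(.sr 0, 0), by simp [DihedralGroup.one_def, -DihedralGroup.r_zero], by simp [hv]⟩
  · exact ⟨(1, 1), by simp, Ne.symm hv⟩

theorem exists_edge_containing_two (n : ℕ) (hn : 3 ≤ n)
    (u v : DihedralGroup n × ZMod 2) (huv : u ≠ v) :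
    ∃ e : Finset (DihedralGroup n × ZMod 2), IsEdge e ∧ u ∈ e ∧ v ∈ e := by
  by_cases hu : u = (1, 0)
  · obtain ⟨w, hw, hwv⟩ := exists_ne_one_and_ne v
    exact ⟨{(1, 0), v, w}, isEdge_one (hu ▸ huv.symm) hw hwv.symm, by simp [hu], by simp⟩
  by_cases hv : v = (1, 0)
  · obtain ⟨w, hw, hwu⟩ := exists_ne_one_and_ne u
    exact ⟨{(1, 0), u, w}, isEdge_one hu hw hwu.symm, by simp, by simp [hv]⟩
  · exact ⟨{(1, 0), u, v}, isEdge_one hu hv huv, by simp, by simp⟩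
end

section
/- Let n ≥ 3 be odd and let D_n be the dihedral group of order 2n. The number of ordered triples (g1,g2,g3) ∈ D_n × D_n × D_n with g2 ≠ g3 and g1·(g3⁻¹·g2) = (g3⁻¹·g2)·g1 equals 2n(2n−1) + 2n(n−1)² + 2n². (This counts the hyperedges of the associating hypergraph on M(D_n,2) arising from triples of the form ((g1,0),(g2,1),(g3,1)).) -/
/-- Substituting `h = g₃⁻¹ * g₂` turns triples `(g₁, g₂, g₃)` with `g₂ ≠ g₃` and `g₁` commuting
with `g₃⁻¹ * g₂` into a free choice of `g₃` and a commuting pair `(g₁, h)` with `h ≠ 1`. -/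
def commuteQuotientEquiv (G : Type*) [Group G] :
    {t : G × G × G //
      t.2.1 ≠ t.2.2 ∧ t.1 * (t.2.2⁻¹ * t.2.1) = (t.2.2⁻¹ * t.2.1) * t.1} ≃
      G × {p : G × G // p.2 ≠ 1 ∧ Commute p.1 p.2} where
  toFun t := (t.1.2.2, ⟨(t.1.1, t.1.2.2⁻¹ * t.1.2.1),
    fun h => t.2.1 (inv_mul_eq_one.mp h).symm, t.2.2⟩)
  invFun q := ⟨(q.2.1.1, q.1 * q.2.1.2, q.1), by simpa using q.2.2.1, by
    simpa only [inv_mul_cancel_left] using q.2.2.2.eq⟩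
  left_inv t := by simp
  right_inv q := by simp

/-- Among commuting pairs, those whose second entry is trivial are indexed by the group itself. -/
theorem card_commute_ne_one_add_card (G : Type*) [Group G] [Finite G] :
    Nat.card {p : G × G // p.2 ≠ 1 ∧ Commute p.1 p.2} + Nat.card G =
      Nat.card {p : G × G // Commute p.1 p.2} := by
  have hdisj : Disjoint {p : G × G | p.2 ≠ 1 ∧ Commute p.1 p.2}
      (Set.range fun g : G => (g, (1 : G))) := by
    rw [Set.disjoint_left]
    rintro _ ⟨h, -⟩ ⟨g, rfl⟩
    exact h rfl
  have hunion : {p : G × G | Commute p.1 p.2} =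
      {p : G × G | p.2 ≠ 1 ∧ Commute p.1 p.2} ∪ Set.range fun g : G => (g, (1 : G)) := by
    ext ⟨g, h⟩
    by_cases hh : h = 1 <;> simp [hh, eq_comm]
  have hcard := Set.ncard_union_eq hdisj
  rw [← hunion, ← Nat.card_coe_set_eq (Set.range _),
    Nat.card_range_of_injective (Prod.mk_left_injective (1 : G))] at hcard
  exact hcard.symm

theorem count_case5_odd (n : ℕ) (hn : 3 ≤ n) (hodd : Odd n) :
    Nat.card {t : DihedralGroup n × DihedralGroup n × DihedralGroup n //
      t.2.1 ≠ t.2.2 ∧ t.1 * (t.2.2⁻¹ * t.2.1) = (t.2.2⁻¹ * t.2.1) * t.1} =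
    2 * n * (2 * n - 1) + 2 * n * (n - 1) ^ 2 + 2 * n ^ 2 := by
  have : NeZero n := ⟨by omega⟩
  have hpairs := card_commute_ne_one_add_card (DihedralGroup n)
  rw [DihedralGroup.card_commute_odd hodd, DihedralGroup.nat_card] at hpairs
  have hcount : Nat.card {p : DihedralGroup n × DihedralGroup n //
      p.2 ≠ 1 ∧ Commute p.1 p.2} = n * (n + 1) := by linarith
  rw [Nat.card_congr (commuteQuotientEquiv _), Nat.card_prod, DihedralGroup.nat_card, hcount]
  obtain ⟨m, rfl⟩ : ∃ m, n = m + 1 := ⟨n - 1, by omega⟩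
  rw [show 2 * (m + 1) - 1 = 2 * m + 1 by omega, Nat.add_sub_cancel]
  ring
end

section
/- Let n ≥ 4 be even and let D_n be the dihedral group of order 2n. The number of ordered triples (g1,g2,g3) ∈ D_n × D_n × D_n with g2 ≠ g3 and g1·(g3⁻¹·g2) = (g3⁻¹·g2)·g1 equals 4n(2n−1) + 2n(n−2)(n−1) + 6n². (This counts the hyperedges of the associating hypergraph on M(D_n,2) arising from triples of the form ((g1,0),(g2,1),(g3,1)).) -/
theorem ZMod.add_self_eq_zero_iff_of_even {m : ℕ} (hm : 0 < m) (i : ZMod (m + m)) :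
    i + i = 0 ↔ i = 0 ∨ i = (m : ZMod (m + m)) := by
  have : NeZero (m + m) := ⟨by omega⟩
  constructor
  · intro h
    have hlt := ZMod.val_lt i
    rw [← ZMod.natCast_zmod_val i, ← Nat.cast_add, ZMod.natCast_eq_zero_iff] at h
    obtain ⟨c, hc⟩ := h
    have hval : i.val = m * c := by linarith
    have hc2 : c < 2 := by
      by_contra! hge
      have := Nat.mul_le_mul_left m hge
      omega
    rw [← ZMod.natCast_zmod_val i, hval]
    interval_cases c <;> simp
  · rintro (rfl | rfl)
    · simp
    · rw [← Nat.cast_add, ZMod.natCast_self]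

theorem ZMod.card_filter_add_self_eq_zero {n : ℕ} [NeZero n] (heven : Even n) :
    (Finset.univ.filter fun i : ZMod n => i + i = 0).card = 2 := by
  obtain ⟨m, rfl⟩ := heven
  have hm : 0 < m := by have := NeZero.ne (m + m); omega
  have hne : (0 : ZMod (m + m)) ≠ m := by
    intro h
    have := Nat.le_of_dvd hm ((ZMod.natCast_eq_zero_iff m (m + m)).1 h.symm)
    omega
  rw [← Finset.card_pair hne]
  congr 1
  ext i
  simp [ZMod.add_self_eq_zero_iff_of_even hm]

namespace DihedralGroup

theorem sum_eq_sum_r_add_sum_sr {n : ℕ} [NeZero n] {M : Type*} [AddCommMonoid M]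
    (f : DihedralGroup n → M) : ∑ g, f g = ∑ i, f (r i) + ∑ i, f (sr i) := by
  let e : ZMod n ⊕ ZMod n ≃ DihedralGroup n :=
    { toFun := Sum.elim r sr
      invFun := fun g => match g with
        | r i => Sum.inl i
        | sr i => Sum.inr i
      left_inv := by rintro (i | i) <;> rfl
      right_inv := by rintro (i | i) <;> rfl }
  rw [← e.sum_comp, Fintype.sum_sum_type]
  rfl

theorem commute_r_r {n : ℕ} (i j : ZMod n) : Commute (r i) (r j) := by
  simp [Commute, SemiconjBy, add_comm]

theorem commute_r_sr_iff {n : ℕ} (i j : ZMod n) : Commute (r i) (sr j) ↔ i + i = 0 := by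
  simp only [Commute, SemiconjBy, r_mul_sr, sr_mul_r, sr.injEq]
  constructor <;> intro h <;> linear_combination -h

theorem commute_sr_sr_iff {n : ℕ} (i j : ZMod n) :
    Commute (sr i) (sr j) ↔ (j - i) + (j - i) = 0 := by
  simp only [Commute, SemiconjBy, sr_mul_sr, r.injEq]
  constructor <;> intro h <;> linear_combination h

theorem card_commute_even {n : ℕ} [NeZero n] (heven : Even n) :
    Nat.card {p : DihedralGroup n × DihedralGroup n // Commute p.1 p.2} = n ^ 2 + 6 * n := by
  classical
  have hT := ZMod.card_filter_add_self_eq_zero heven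
  have hfix : ∑ i : ZMod n, (if i + i = 0 then 1 else 0) = 2 := by
    rw [Finset.sum_boole, hT, Nat.cast_ofNat]
  have hshift (i : ZMod n) :
      ∑ j : ZMod n, (if (j - i) + (j - i) = 0 then 1 else 0) = 2 :=
    ((Equiv.subRight i).sum_comp fun j => if j + j = 0 then 1 else 0).trans hfix
  rw [Nat.card_eq_fintype_card, Fintype.card_subtype, Finset.card_filter,
    Fintype.sum_prod_type, sum_eq_sum_r_add_sum_sr]
  simp only [sum_eq_sum_r_add_sum_sr, commute_r_r, commute_r_sr_iff, commute_sr_sr_iff,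
    Commute.symm_iff (a := sr _) (b := r _), hshift, hfix, Finset.sum_add_distrib]
  rw [Finset.sum_comm (f := fun i _ : ZMod n => if i + i = 0 then 1 else 0)]
  simp only [hfix, if_true, Finset.sum_const, Finset.card_univ, ZMod.card, smul_eq_mul]
  ring

end DihedralGroup

theorem card_commute_inv_mul (G : Type*) [Group G] :
    Nat.card {t : G × G × G //
      t.2.1 ≠ t.2.2 ∧ t.1 * (t.2.2⁻¹ * t.2.1) = (t.2.2⁻¹ * t.2.1) * t.1} =
    Nat.card G * Nat.card {p : G × G // p.2 ≠ 1 ∧ Commute p.1 p.2} := by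
  rw [← Nat.card_prod]
  exact Nat.card_congr
    { toFun := fun t => (t.1.2.2, ⟨(t.1.1, t.1.2.2⁻¹ * t.1.2.1),
        fun h => t.2.1 (inv_mul_eq_one.1 h).symm, t.2.2⟩)
      invFun := fun q => ⟨(q.2.1.1, q.1 * q.2.1.2, q.1), by
        simpa using q.2.2.1, by simpa using q.2.2.2.eq⟩
      left_inv := fun t => by simp
      right_inv := fun q => by simp }

theorem count_case5_even (n : ℕ) (hn : 4 ≤ n) (heven : Even n) :
    Nat.card {t : DihedralGroup n × DihedralGroup n × DihedralGroup n //
      t.2.1 ≠ t.2.2 ∧ t.1 * (t.2.2⁻¹ * t.2.1) = (t.2.2⁻¹ * t.2.1) * t.1} =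
    4 * n * (2 * n - 1) + 2 * n * (n - 2) * (n - 1) + 6 * n ^ 2 := by
  have : NeZero n := ⟨by omega⟩
  have hpairs := card_commute_ne_one_add_card (DihedralGroup n)
  rw [DihedralGroup.card_commute_even heven, DihedralGroup.nat_card] at hpairs
  rw [card_commute_inv_mul, DihedralGroup.nat_card,
    show Nat.card _ = n ^ 2 + 4 * n from by omega]
  obtain ⟨k, rfl⟩ := Nat.exists_eq_add_of_le hn
  rw [show 2 * (4 + k) - 1 = 2 * k + 7 by omega, show 4 + k - 2 = k + 2 by omega,
    show 4 + k - 1 = k + 3 by omega]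
  ring
end

section
/- Let n ≥ 3. The covering number of the associating hypergraph H on M(D_n,2), i.e., the minimum number of hyperedges of H whose union contains every vertex of H, equals n + ⌈n/3⌉. -/
lemma assoc3_zero {G : Type*} [Group G] (x y z : G) :
    Assoc3 ((x, 0) : G × ZMod 2) (y, 0) (z, 0) := by
  simp [Assoc3, Mop, mul_assoc]

lemma assoc3_one_iff {G : Type*} [Group G] (x y z : G) :
    Assoc3 ((x, 1) : G × ZMod 2) (y, 1) (z, 1) ↔ z * (y⁻¹ * x) = x * (z⁻¹ * y)⁻¹ := by
  have h : (1 + 1 : ZMod 2) = 0 := rfl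
  simp [Assoc3, Mop, h, ZMod.val_one]

lemma assoc3_zero_one_one_iff {G : Type*} [Group G] (x y z : G) :
    Assoc3 ((x, 0) : G × ZMod 2) (y, 1) (z, 1) ↔ z⁻¹ * (y * x) = x * (z⁻¹ * y) := by
  have h : (1 + 1 : ZMod 2) = 0 := rfl
  simp [Assoc3, Mop, h, ZMod.val_one]

/-- `A` is contained in the union of at most `k` hyperedges. -/
def CoveredBy {n : ℕ} (A : Finset (DihedralGroup n × ZMod 2)) (k : ℕ) : Prop :=
  ∃ F : Finset (Finset (DihedralGroup n × ZMod 2)),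
    (∀ e ∈ F, IsEdge e) ∧ (∀ v ∈ A, ∃ e ∈ F, v ∈ e) ∧ F.card ≤ k

namespace CoveredBy

variable {n : ℕ} {A B : Finset (DihedralGroup n × ZMod 2)} {k l : ℕ}

lemma union (hA : CoveredBy A k) (hB : CoveredBy B l) : CoveredBy (A ∪ B) (k + l) := by
  obtain ⟨F, hF, hFA, hFk⟩ := hA
  obtain ⟨F', hF', hFB, hFl⟩ := hB
  refine ⟨F ∪ F', fun e he => ?_, fun v hv => ?_, (Finset.card_union_le _ _).trans (by omega)⟩
  · exact (Finset.mem_union.1 he).elim (hF e) (hF' e)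
  · rcases Finset.mem_union.1 hv with h | h
    · obtain ⟨e, he, hve⟩ := hFA v h
      exact ⟨e, Finset.mem_union_left _ he, hve⟩
    · obtain ⟨e, he, hve⟩ := hFB v h
      exact ⟨e, Finset.mem_union_right _ he, hve⟩

lemma of_isEdge (h : IsEdge A) : CoveredBy A 1 :=
  ⟨{A}, by simpa using h, fun v hv => ⟨A, by simp, hv⟩, by simp⟩

lemma mono (hA : CoveredBy A k) (hBA : B ⊆ A) (hkl : k ≤ l) : CoveredBy B l := by
  obtain ⟨F, hF, hFA, hFk⟩ := hA
  exact ⟨F, hF, fun v hv => hFA v (hBA hv), hFk.trans hkl⟩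

/-- A subset of a set all of whose triples associate can be covered greedily. -/
lemma of_assoc {C : Finset (DihedralGroup n × ZMod 2)}
    (hC : ∀ x ∈ C, ∀ y ∈ C, ∀ z ∈ C, Assoc3 x y z) (hC3 : 3 ≤ C.card)
    (hAC : A ⊆ C) (hAk : A.card ≤ 3 * k) : CoveredBy A k := by
  induction k generalizing A with
  | zero =>
    have : A = ∅ := by simpa using hAk
    exact ⟨∅, by simp, by simp [this], by simp⟩
  | succ k ih =>
    obtain ⟨T, hTC, hT3, hT⟩ : ∃ T ⊆ C, T.card = 3 ∧ (A \ T).card ≤ 3 * k := by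
      rcases le_total A.card 3 with h | h
      · obtain ⟨T, hAT, hTC, hT⟩ := Finset.exists_subsuperset_card_eq hAC h hC3
        exact ⟨T, hTC, hT, by simp [Finset.sdiff_eq_empty_iff_subset.2 hAT]⟩
      · obtain ⟨T, hTA, hT⟩ := Finset.exists_subset_card_eq h
        refine ⟨T, hTA.trans hAC, hT, ?_⟩
        rw [Finset.card_sdiff_of_subset hTA]
        omega
    have hedge : IsEdge T := by
      obtain ⟨x, y, z, hxy, hxz, hyz, rfl⟩ := Finset.card_eq_three.1 hT3
      exact ⟨x, y, z, hxy, hxz, hyz, rfl,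
        hC x (hTC (by simp)) y (hTC (by simp)) z (hTC (by simp))⟩
    refine ((ih (Finset.sdiff_subset.trans hAC) hT).union (of_isEdge hedge)).mono ?_ le_rfl
    intro v hv
    by_cases h : v ∈ T <;> simp [h, hv]

variable [NeZero n]

lemma image_zero (hn : 3 ≤ n) (T : Finset (DihedralGroup n)) (hT : T.card ≤ 3 * k) :
    CoveredBy (T.image fun g => (g, (0 : ZMod 2))) k := by
  refine of_assoc (C := Finset.univ.image fun g => (g, (0 : ZMod 2))) ?_ ?_
    (Finset.image_subset_image (Finset.subset_univ _)) (Finset.card_image_le.trans hT)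
  · simp only [Finset.mem_image, Finset.mem_univ, true_and]
    rintro _ ⟨x, rfl⟩ _ ⟨y, rfl⟩ _ ⟨z, rfl⟩
    exact assoc3_zero x y z
  · rw [Finset.card_image_of_injective _ (fun _ _ h => (Prod.mk.inj h).1), Finset.card_univ,
      DihedralGroup.card]
    omega

lemma image_r_one (hn : 3 ≤ n) (T : Finset (ZMod n)) (hT : T.card ≤ 3 * k) :
    CoveredBy (T.image fun i => (DihedralGroup.r i, (1 : ZMod 2))) k := by
  refine of_assoc (C := Finset.univ.image fun i => (DihedralGroup.r i, (1 : ZMod 2))) ?_ ?_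
    (Finset.image_subset_image (Finset.subset_univ _)) (Finset.card_image_le.trans hT)
  · simp only [Finset.mem_image, Finset.mem_univ, true_and]
    rintro _ ⟨x, rfl⟩ _ ⟨y, rfl⟩ _ ⟨z, rfl⟩
    rw [assoc3_one_iff]
    simp
    ring
  · rw [Finset.card_image_of_injective _ (fun _ _ h => by simpa using h), Finset.card_univ,
      ZMod.card]
    exact hn

lemma image_sr_one (hn : 3 ≤ n) (T : Finset (ZMod n)) (hT : T.card ≤ 3 * k) :
    CoveredBy (T.image fun i => (DihedralGroup.sr i, (1 : ZMod 2))) k := by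
  refine of_assoc (C := Finset.univ.image fun i => (DihedralGroup.sr i, (1 : ZMod 2))) ?_ ?_
    (Finset.image_subset_image (Finset.subset_univ _)) (Finset.card_image_le.trans hT)
  · simp only [Finset.mem_image, Finset.mem_univ, true_and]
    rintro _ ⟨x, rfl⟩ _ ⟨y, rfl⟩ _ ⟨z, rfl⟩
    rw [assoc3_one_iff]
    simp
    ring
  · rw [Finset.card_image_of_injective _ (fun _ _ h => by simpa using h), Finset.card_univ,
      ZMod.card]
    exact hn

end CoveredBy

lemma isEdge_one_r_sr {n : ℕ} (i j : ZMod n) :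
    IsEdge {((1 : DihedralGroup n), (0 : ZMod 2)), (.r i, 1), (.sr j, 1)} :=
  ⟨_, _, _, by simp, by simp, by simp, rfl, by simp [assoc3_zero_one_one_iff]⟩

lemma isEdge_sr_r_sr {n : ℕ} :
    IsEdge {((.sr 0 : DihedralGroup n), (0 : ZMod 2)), (.r 0, 1), (.sr 0, 1)} :=
  ⟨_, _, _, by simp, by simp, by simp [-DihedralGroup.r_zero], rfl,
    by simp [assoc3_zero_one_one_iff]⟩

lemma coveredBy_univ {n : ℕ} [NeZero n] (hn : 3 ≤ n) :
    CoveredBy (Finset.univ : Finset (DihedralGroup n × ZMod 2)) (n + (n + 2) / 3) := by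
  have hG : Fintype.card (DihedralGroup n) = 2 * n := DihedralGroup.card
  have hZ : Fintype.card (ZMod n) = n := ZMod.card n
  obtain ⟨m, rfl | rfl | rfl⟩ : ∃ m, n = 3 * m ∨ n = 3 * m + 1 ∨ n = 3 * m + 2 :=
    ⟨n / 3, by omega⟩
  · have h0 := CoveredBy.image_zero (k := 2 * m) hn Finset.univ (by rw [Finset.card_univ]; omega)
    have hr := CoveredBy.image_r_one (k := m) hn Finset.univ (by rw [Finset.card_univ]; omega)
    have hs := CoveredBy.image_sr_one (k := m) hn Finset.univ (by rw [Finset.card_univ]; omega)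
    refine ((h0.union hr).union hs).mono ?_ (by omega)
    rintro ⟨g, a⟩ -
    obtain rfl | rfl : a = 0 ∨ a = 1 := by revert a; decide
    all_goals rcases g with i | i <;> simp
  · have hc : (Finset.univ \ {0} : Finset (ZMod (3 * m + 1))).card ≤ 3 * m := by
      rw [Finset.card_sdiff_of_subset (by simp), Finset.card_univ, Finset.card_singleton]
      omega
    have h0 := CoveredBy.image_zero (k := 2 * m + 1) hn Finset.univ
      (by rw [Finset.card_univ]; omega)
    have hr := CoveredBy.image_r_one (k := m) hn _ hc
    have hs := CoveredBy.image_sr_one (k := m) hn _ hc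
    refine (((h0.union hr).union hs).union (.of_isEdge (isEdge_one_r_sr 0 0))).mono ?_ (by omega)
    rintro ⟨g, a⟩ -
    obtain rfl | rfl : a = 0 ∨ a = 1 := by revert a; decide
    all_goals rcases g with i | i <;> by_cases hi : i = 0 <;> simp [hi]
  · have : Fact (1 < 3 * m + 2) := ⟨by omega⟩
    have hc : (Finset.univ \ {0, 1} : Finset (ZMod (3 * m + 2))).card ≤ 3 * m := by
      rw [Finset.card_sdiff_of_subset (by simp), Finset.card_univ, Finset.card_pair zero_ne_one]
      omega
    have h0 := CoveredBy.image_zero (k := 2 * m + 1) hn (Finset.univ \ {.sr 0})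
      (by rw [Finset.card_sdiff_of_subset (by simp), Finset.card_univ, Finset.card_singleton]
          omega)
    have hr := CoveredBy.image_r_one (k := m) hn _ hc
    have hs := CoveredBy.image_sr_one (k := m) hn _ hc
    refine ((((h0.union hr).union hs).union (.of_isEdge (isEdge_one_r_sr 1 1))).union
      (.of_isEdge isEdge_sr_r_sr)).mono ?_ (by omega)
    rintro ⟨g, a⟩ -
    obtain rfl | rfl : a = 0 ∨ a = 1 := by revert a; decide
    all_goals rcases g with i | i <;> by_cases hi : i = 0 <;>
      by_cases hi' : i = 1 <;> simp [hi, hi']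

lemma IsEdge.card_le {n : ℕ} {e : Finset (DihedralGroup n × ZMod 2)} (he : IsEdge e) :
    e.card ≤ 3 := by
  obtain ⟨a, b, c, -, -, -, rfl, -⟩ := he
  exact Finset.card_le_three

lemma le_card_of_cover {n : ℕ} [NeZero n] {F : Finset (Finset (DihedralGroup n × ZMod 2))}
    (hF : ∀ e ∈ F, IsEdge e) (hcov : ∀ v : DihedralGroup n × ZMod 2, ∃ e ∈ F, v ∈ e) :
    n + (n + 2) / 3 ≤ F.card := by
  have hle : (F.biUnion id).card ≤ F.card * 3 :=
    Finset.card_biUnion_le_card_mul _ _ _ fun e he => (hF e he).card_le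
  have huniv : F.biUnion id = Finset.univ :=
    Finset.eq_univ_of_forall fun v => by simpa using hcov v
  rw [huniv, Finset.card_univ, Fintype.card_prod, DihedralGroup.card, ZMod.card] at hle
  omega

theorem covering_number (n : ℕ) (hn : 3 ≤ n) :
    IsLeast {k : ℕ | ∃ F : Finset (Finset (DihedralGroup n × ZMod 2)),
      (∀ e ∈ F, IsEdge e) ∧ (∀ v : DihedralGroup n × ZMod 2, ∃ e ∈ F, v ∈ e) ∧
      F.card = k} (n + (n + 2) / 3) := by
  have : NeZero n := ⟨by omega⟩
  constructor
  · obtain ⟨F, hF, hcov, hk⟩ := coveredBy_univ hn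
    have hcov' : ∀ v, ∃ e ∈ F, v ∈ e := fun v => hcov v (Finset.mem_univ v)
    exact ⟨F, hF, hcov', hk.antisymm (le_card_of_cover hF hcov')⟩
  · rintro k ⟨F, hF, hcov, rfl⟩
    exact le_card_of_cover hF hcov
end
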